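/- Let θ = 1/4 and σ ∈ (0,1). Let s be the substitution on the alphabet {A,B,C,D} defined by s(A) = A, s(B) = AB, s(C) = AC, s(D) = ABC, and let φ : {A,B,C,D}* → {1,2}* be the monoid morphism φ(A) = 1221, φ(B) = 12221, φ(C) = 12211, φ(D) = 122211. Then the language L(T_{1/4,σ}) equals the set of all finite words over {1,2} that are factors of one of the periodic infinite words 1^ω, 2^ω, or (φ(s^n(X)))^ω for some n ∈ ℕ and X ∈ {B, C, D}. -/

import Mathlib

/-- The piecewise rotation `T_{θ,σ}`:
`T_{θ,σ}(z) = e^{2πiθ}(z+σ+1)` if `Im z > 0` and `e^{2πiθ}(z+σ-1)` if `Im z < 0`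
(points of the real axis are excluded from the dynamics). -/
noncomputable def pwRot (θ σ : ℝ) (z : ℂ) : ℂ :=
  if 0 < z.im then Complex.exp (2 * Real.pi * θ * Complex.I) * (z + σ + 1)
  else Complex.exp (2 * Real.pi * θ * Complex.I) * (z + σ - 1)

/-- `z` has a well-defined orbit: it never hits the real axis. -/
def goodOrbit (θ σ : ℝ) (z : ℂ) : Prop := ∀ n : ℕ, ((pwRot θ σ)^[n] z).im ≠ 0

/-- The itinerary of `z`, with letters `1` and `2`. -/
noncomputable def itin (θ σ : ℝ) (z : ℂ) (n : ℕ) : ℕ :=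
  if 0 < ((pwRot θ σ)^[n] z).im then 1 else 2

/-- The language of the piecewise rotation: finite words over `{1,2}` occurring as
factors of itineraries of points with well-defined orbit. -/
def lang (θ σ : ℝ) : Set (List ℕ) :=
  {w | ∃ z : ℂ, goodOrbit θ σ z ∧ ∃ i : ℕ,
      w = (List.range w.length).map fun k => itin θ σ z (i + k)}

/-- The alphabet `{A,B,C,D}`. -/
inductive Letter | A | B | C | D
deriving DecidableEq

/-- The substitution `s : A ↦ A, B ↦ AB, C ↦ AC, D ↦ ABC` (on letters). -/
def substLetter : Letter → List Letter
  | .A => [.A]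
  | .B => [.A, .B]
  | .C => [.A, .C]
  | .D => [.A, .B, .C]

/-- The substitution `s` extended to words. -/
def substWord (w : List Letter) : List Letter := w.flatMap substLetter

/-- The morphism `φ : A ↦ 1221, B ↦ 12221, C ↦ 12211, D ↦ 122211` (on letters). -/
def phiLetter : Letter → List ℕ
  | .A => [1, 2, 2, 1]
  | .B => [1, 2, 2, 2, 1]
  | .C => [1, 2, 2, 1, 1]
  | .D => [1, 2, 2, 2, 1, 1]

/-! ### An integer model of the quarter-turn piecewise rotation

A state `(p, q, s, t)` records the integer parts of the halves of two consecutive imaginary parts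
of an orbit, together with the classes `s, t ∈ {0, 1}` of their fractional parts. -/

/-- One step of the integer model. -/
def latticeStep (x : ℤ × ℤ × ℤ × ℤ) : ℤ × ℤ × ℤ × ℤ :=
  (x.2.1, -x.1 - x.2.2.1 - (if x.2.1 < 0 then 1 else 0), x.2.2.2, x.2.2.1)

/-- The letter read off a state. -/
def latticeLetter (x : ℤ × ℤ × ℤ × ℤ) : ℕ := if 0 ≤ x.1 then 1 else 2

/-- The classes of a state are `0` or `1`. -/
def LatticeValid (x : ℤ × ℤ × ℤ × ℤ) : Prop :=
  (x.2.2.1 = 0 ∨ x.2.2.1 = 1) ∧ (x.2.2.2 = 0 ∨ x.2.2.2 = 1)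

/-- The first `n` letters of the itinerary of a state. -/
def latticeWord (x : ℤ × ℤ × ℤ × ℤ) : ℕ → List ℕ
  | 0 => []
  | n + 1 => latticeLetter x :: latticeWord (latticeStep x) n

/-- Reading the word `w` from the state `x` leads to the state `y`. -/
def LatticePath (x : ℤ × ℤ × ℤ × ℤ) (w : List ℕ) (y : ℤ × ℤ × ℤ × ℤ) : Prop :=
  latticeWord x w.length = w ∧ latticeStep^[w.length] x = y

theorem latticeStep_injective : Function.Injective latticeStep := by
  rintro ⟨p, q, s, t⟩ ⟨p', q', s', t'⟩ h
  simp only [latticeStep, Prod.mk.injEq] at h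
  obtain ⟨rfl, h, rfl, rfl⟩ := h
  simp only [Prod.mk.injEq, and_true]
  omega

theorem LatticeValid.step {x : ℤ × ℤ × ℤ × ℤ} (h : LatticeValid x) :
    LatticeValid (latticeStep x) := ⟨h.2, h.1⟩

theorem LatticeValid.iterate {x : ℤ × ℤ × ℤ × ℤ} (h : LatticeValid x) (n : ℕ) :
    LatticeValid (latticeStep^[n] x) := by
  induction n with
  | zero => exact h
  | succ n ih => rw [Function.iterate_succ_apply']; exact ih.step

theorem latticeWord_eq_map (x : ℤ × ℤ × ℤ × ℤ) (n : ℕ) :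
    latticeWord x n = (List.range n).map fun k => latticeLetter (latticeStep^[k] x) := by
  induction n generalizing x with
  | zero => rfl
  | succ n ih =>
    rw [latticeWord, ih, List.range_succ_eq_map, List.map_cons, List.map_map]
    rfl

theorem length_latticeWord (x : ℤ × ℤ × ℤ × ℤ) (n : ℕ) : (latticeWord x n).length = n := by
  simp [latticeWord_eq_map]

theorem latticeWord_add (x : ℤ × ℤ × ℤ × ℤ) (m n : ℕ) :
    latticeWord x (m + n) = latticeWord x m ++ latticeWord (latticeStep^[m] x) n := by
  induction m generalizing x with
  | zero => simp [latticeWord]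
  | succ m ih =>
    rw [Nat.add_right_comm, latticeWord, ih]
    rfl

theorem latticePath_nil (x : ℤ × ℤ × ℤ × ℤ) : LatticePath x [] x := ⟨rfl, rfl⟩

theorem LatticePath.append {x y z : ℤ × ℤ × ℤ × ℤ} {v w : List ℕ} (h : LatticePath x v y)
    (h' : LatticePath y w z) : LatticePath x (v ++ w) z := by
  constructor
  · rw [List.length_append, latticeWord_add, h.1, h.2, h'.1]
  · rw [List.length_append, add_comm, Function.iterate_add_apply, h.2, h'.2]

theorem LatticePath.cons {x z : ℤ × ℤ × ℤ × ℤ} {a : ℕ} {w : List ℕ} (ha : latticeLetter x = a)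
    (h : LatticePath (latticeStep x) w z) : LatticePath x (a :: w) z := by
  refine ⟨?_, h.2⟩
  rw [List.length_cons, latticeWord, ha, h.1]

theorem LatticePath.replicate {x : ℤ × ℤ × ℤ × ℤ} {w : List ℕ} (h : LatticePath x w x) (m : ℕ) :
    LatticePath x (List.replicate m w).flatten x := by
  induction m with
  | zero => exact latticePath_nil x
  | succ m ih =>
    rw [List.replicate_succ, List.flatten_cons]
    exact h.append ih

theorem LatticePath.eq_latticeWord_of_factor {x y : ℤ × ℤ × ℤ × ℤ} {v w : List ℕ}
    (h : LatticePath x w y) (hv : v <:+: w) :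
    ∃ i : ℕ, v = latticeWord (latticeStep^[i] x) v.length := by
  obtain ⟨a, b, rfl⟩ := hv
  have h' := h.1
  rw [List.length_append, List.length_append, latticeWord_add, latticeWord_add] at h'
  have h1 := (List.append_inj h' (by simp [length_latticeWord])).1
  exact ⟨a.length, (List.append_inj h1 (length_latticeWord _ _)).2.symm⟩

/-! ### Periodic orbits of the integer model -/

theorem latticePath_1221 {p q s t : ℤ} (hs : s = 0 ∨ s = 1) (ht : t = 0 ∨ t = 1) (hp : 0 ≤ p)
    (hq : q + t + 1 ≤ 0) :
    LatticePath (p, q, s, t) [1, 2, 2, 1] (p + 1, q + 1, s, t) := by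
  refine ⟨?_, ?_⟩
  · simp only [List.length_cons, List.length_nil, latticeWord, latticeStep, latticeLetter,
      List.cons.injEq, and_true]
    refine ⟨?_, ?_, ?_, ?_⟩ <;> grind
  · simp only [List.length_cons, List.length_nil, Function.iterate_succ, Function.iterate_zero,
      Function.comp, id, latticeStep, Prod.mk.injEq, and_true]
    constructor <;> grind

theorem latticePath_1221_replicate {s t : ℤ} (hs : s = 0 ∨ s = 1) (ht : t = 0 ∨ t = 1) (n : ℕ)
    {p q : ℤ} (hp : 0 ≤ p) (hq : q + t + n ≤ 0) :
    LatticePath (p, q, s, t) (List.replicate n [1, 2, 2, 1]).flatten (p + n, q + n, s, t) := by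
  induction n generalizing p q with
  | zero => simpa using latticePath_nil (p, q, s, t)
  | succ n ih =>
    rw [List.replicate_succ, List.flatten_cons]
    push_cast at hq ⊢
    have := (latticePath_1221 hs ht hp (by omega)).append
      (ih (p := p + 1) (q := q + 1) (by omega) (by omega))
    convert this using 2
    · ring
    · congr 1
      ring

theorem latticePath_1 {p s : ℤ} (hp : 0 ≤ p) :
    LatticePath (p, 0, s, 0) [1] (0, -p - s, 0, s) := by
  simp [LatticePath, latticeWord, latticeStep, latticeLetter, hp]

theorem latticePath_12221 {p s : ℤ} (hs : s = 0 ∨ s = 1) (hp : 0 ≤ p) :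
    LatticePath (p, -1, s, 1) [1, 2, 2, 2, 1] (0, -p - s, 1, s) := by
  refine ⟨?_, ?_⟩
  · simp only [List.length_cons, List.length_nil, latticeWord, latticeStep, latticeLetter,
      List.cons.injEq, and_true]
    refine ⟨?_, ?_, ?_, ?_, ?_⟩ <;> grind
  · simp only [List.length_cons, List.length_nil, Function.iterate_succ, Function.iterate_zero,
      Function.comp, id, latticeStep, Prod.mk.injEq, and_true]
    constructor <;> grind

/-- The words whose periodic repetitions are the itineraries. -/
def periodWords : Set (List ℕ) :=
  {w | w = [1] ∨ w = [2] ∨ ∃ (n : ℕ) (X : Letter),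
    X ∈ ({Letter.B, Letter.C, Letter.D} : Set Letter) ∧
      w = (substWord^[n] [X]).flatMap phiLetter}

theorem substWord_append (u v : List Letter) :
    substWord (u ++ v) = substWord u ++ substWord v := List.flatMap_append

theorem substWord_replicate_A (n : ℕ) :
    substWord (List.replicate n .A) = List.replicate n .A := by
  induction n with
  | zero => rfl
  | succ n ih =>
    rw [List.replicate_succ, ← List.singleton_append, substWord_append, ih]
    rfl

theorem substWord_iterate_B (n : ℕ) :
    substWord^[n] [.B] = List.replicate n .A ++ [.B] := by
  induction n with
  | zero => rfl
  | succ n ih =>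
    rw [Function.iterate_succ_apply', ih, substWord_append, substWord_replicate_A,
      List.replicate_succ', List.append_assoc]
    rfl

theorem substWord_iterate_C (n : ℕ) :
    substWord^[n] [.C] = List.replicate n .A ++ [.C] := by
  induction n with
  | zero => rfl
  | succ n ih =>
    rw [Function.iterate_succ_apply', ih, substWord_append, substWord_replicate_A,
      List.replicate_succ', List.append_assoc]
    rfl

theorem substWord_iterate_D (n : ℕ) :
    substWord^[n + 1] [.D] =
      List.replicate (n + 1) .A ++ [.B] ++ (List.replicate n .A ++ [.C]) := by
  induction n with
  | zero => rfl
  | succ n ih =>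
    rw [Function.iterate_succ_apply', ih]
    simp only [substWord_append, substWord_replicate_A]
    rw [List.replicate_succ' (n := n + 1)]
    rw [List.replicate_succ' (n := n)]
    simp [substWord, substLetter]

theorem flatMap_phiLetter_replicate_A (n : ℕ) :
    (List.replicate n Letter.A).flatMap phiLetter = (List.replicate n [1, 2, 2, 1]).flatten := by
  rw [List.flatMap_def, List.map_replicate]
  rfl

theorem phi_iterate_B (n : ℕ) : (substWord^[n] [.B]).flatMap phiLetter =
    (List.replicate n [1, 2, 2, 1]).flatten ++ [1, 2, 2, 2, 1] := by
  rw [substWord_iterate_B, List.flatMap_append, flatMap_phiLetter_replicate_A]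
  rfl

theorem phi_iterate_C (n : ℕ) : (substWord^[n] [.C]).flatMap phiLetter =
    (List.replicate (n + 1) [1, 2, 2, 1]).flatten ++ [1] := by
  rw [substWord_iterate_C, List.flatMap_append, flatMap_phiLetter_replicate_A,
    List.replicate_succ']
  simp [phiLetter]

theorem phi_iterate_D (n : ℕ) : (substWord^[n] [.D]).flatMap phiLetter =
    (List.replicate n [1, 2, 2, 1]).flatten ++ [1, 2, 2, 2, 1] ++
      ((List.replicate n [1, 2, 2, 1]).flatten ++ [1]) := by
  cases n with
  | zero => rfl
  | succ n =>
    rw [substWord_iterate_D, ← substWord_iterate_C, List.flatMap_append, List.flatMap_append,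
      flatMap_phiLetter_replicate_A, phi_iterate_C]
    rfl

theorem latticePath_iterate_B (n : ℕ) :
    LatticePath (0, -n - 1, 1, 1) ((substWord^[n] [.B]).flatMap phiLetter) (0, -n - 1, 1, 1) := by
  rw [phi_iterate_B]
  have h := latticePath_1221_replicate (s := 1) (t := 1) (by simp) (by simp) n (p := 0)
    (q := -n - 1) le_rfl (by omega)
  rw [show (0 : ℤ) + n = n by ring, show -(n : ℤ) - 1 + n = -1 by ring] at h
  exact h.append (latticePath_12221 (by simp) (by simp))

theorem latticePath_replicate_one (n : ℕ) :
    LatticePath (0, -n, 0, 0) ((List.replicate n [1, 2, 2, 1]).flatten ++ [1]) (0, -n, 0, 0) := by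
  have h := latticePath_1221_replicate (s := 0) (t := 0) (by simp) (by simp) n (p := 0)
    (q := -n) le_rfl (by omega)
  rw [show (0 : ℤ) + n = n by ring, show -(n : ℤ) + n = 0 by ring] at h
  simpa using h.append (latticePath_1 (s := 0) (by simp))

theorem latticePath_to_swap (n : ℕ) :
    LatticePath (0, -n, 1, 0) ((List.replicate n [1, 2, 2, 1]).flatten ++ [1])
      (0, -n - 1, 0, 1) := by
  have h := latticePath_1221_replicate (s := 1) (t := 0) (by simp) (by simp) n (p := 0)
    (q := -n) le_rfl (by omega)
  rw [show (0 : ℤ) + n = n by ring, show -(n : ℤ) + n = 0 by ring] at h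
  exact h.append (latticePath_1 (by simp))

theorem latticePath_iterate_D (n : ℕ) :
    LatticePath (0, -n - 1, 0, 1) ((substWord^[n] [.D]).flatMap phiLetter) (0, -n - 1, 0, 1) := by
  rw [phi_iterate_D]
  have h := latticePath_1221_replicate (s := 0) (t := 1) (by simp) (by simp) n (p := 0)
    (q := -n - 1) le_rfl (by omega)
  rw [show (0 : ℤ) + n = n by ring, show -(n : ℤ) - 1 + n = -1 by ring] at h
  have h' := h.append (latticePath_12221 (by simp) (by simp))
  rw [sub_zero] at h'
  exact h'.append (latticePath_to_swap n)

theorem latticePath_two : LatticePath (-1, -1, 1, 1) [2] (-1, -1, 1, 1) := by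
  simp [LatticePath, latticeWord, latticeStep, latticeLetter]

theorem exists_latticePath_of_mem_periodWords {w : List ℕ} (hw : w ∈ periodWords) :
    ∃ x, LatticeValid x ∧ LatticePath x w x := by
  rcases hw with rfl | rfl | ⟨n, X, hX, rfl⟩
  · exact ⟨(0, 0, 0, 0), by simp [LatticeValid], by simpa using latticePath_replicate_one 0⟩
  · exact ⟨_, by simp [LatticeValid], latticePath_two⟩
  · rcases hX with rfl | rfl | rfl
    · exact ⟨_, by simp [LatticeValid], latticePath_iterate_B n⟩
    · rw [phi_iterate_C]
      exact ⟨_, by simp [LatticeValid], latticePath_replicate_one (n + 1)⟩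
    · exact ⟨_, by simp [LatticeValid], latticePath_iterate_D n⟩

/-! ### Every orbit of the integer model is periodic -/

/-- The orbit of `x` meets a state from which a period word leads back to itself. -/
def ReachesCycle (x : ℤ × ℤ × ℤ × ℤ) : Prop :=
  ∃ m : ℕ, ∃ w ∈ periodWords, w ≠ [] ∧ LatticePath (latticeStep^[m] x) w (latticeStep^[m] x)

theorem ReachesCycle.of_path {x y : ℤ × ℤ × ℤ × ℤ} {v : List ℕ} (h : LatticePath x v y)
    (hy : ReachesCycle y) : ReachesCycle x := by
  obtain ⟨m, w, hw⟩ := hy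
  refine ⟨m + v.length, w, ?_⟩
  rwa [Function.iterate_add_apply, h.2]

theorem ReachesCycle.of_step {x : ℤ × ℤ × ℤ × ℤ} (h : ReachesCycle (latticeStep x)) :
    ReachesCycle x :=
  h.of_path (LatticePath.cons rfl (latticePath_nil _))

theorem reachesCycle_zero {s t : ℤ} (hs : s = 0 ∨ s = 1) (ht : t = 0 ∨ t = 1) {q : ℤ}
    (hq : 0 ≤ -q - t) : ReachesCycle (0, q, s, t) := by
  obtain ⟨n, hn⟩ := Int.eq_ofNat_of_zero_le hq
  have hD : ReachesCycle (0, -n - 1, 0, 1) :=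
    ⟨0, _, Or.inr (Or.inr ⟨n, .D, by simp, rfl⟩), by simp [phi_iterate_D],
      latticePath_iterate_D n⟩
  rcases ht with rfl | rfl
  · obtain rfl : q = -n := by omega
    rcases hs with rfl | rfl
    · refine ⟨0, _, ?_, ?_, latticePath_replicate_one n⟩
      · cases n with
        | zero => exact Or.inl rfl
        | succ n => exact Or.inr (Or.inr ⟨n, .C, by simp, (phi_iterate_C n).symm⟩)
      · simp
    · exact hD.of_path (latticePath_to_swap n)
  · obtain rfl : q = -n - 1 := by omega
    rcases hs with rfl | rfl
    · exact hD
    · exact ⟨0, _, Or.inr (Or.inr ⟨n, .B, by simp, rfl⟩), by simp [phi_iterate_B],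
        latticePath_iterate_B n⟩

theorem reachesCycle_of_nonneg_of_le {s t : ℤ} (hs : s = 0 ∨ s = 1) (ht : t = 0 ∨ t = 1)
    {p q : ℤ} (hp : 0 ≤ p) (hq : 0 ≤ -q - t) : ReachesCycle (p, q, s, t) := by
  obtain ⟨n, hn⟩ := Int.eq_ofNat_of_zero_le hq
  refine .of_path (latticePath_1221_replicate hs ht n hp (by omega)) ?_
  rw [show q + n = -t by omega]
  rcases ht with rfl | rfl
  · exact .of_path (latticePath_1 (by omega)) (reachesCycle_zero (by simp) hs (by omega))
  · exact .of_path (latticePath_12221 hs (by omega)) (reachesCycle_zero (by simp) hs (by omega))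

theorem LatticeValid.reachesCycle {x : ℤ × ℤ × ℤ × ℤ} (h : LatticeValid x) : ReachesCycle x := by
  have key_pos : ∀ {p q s t : ℤ}, (s = 0 ∨ s = 1) → (t = 0 ∨ t = 1) → 0 ≤ q →
      ReachesCycle (p, q, s, t) := by
    have key : ∀ {p q s t : ℤ}, (s = 0 ∨ s = 1) → (t = 0 ∨ t = 1) → 0 ≤ p → 0 ≤ q →
        ReachesCycle (p, q, s, t) := fun {p q s t} hs ht hp hq => by
      refine .of_step ?_
      simp only [latticeStep, if_neg hq.not_gt]
      exact reachesCycle_of_nonneg_of_le ht hs hq (by omega)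
    intro p q s t hs ht hq
    rcases le_or_gt 0 p with hp | hp
    · exact key hs ht hp hq
    · refine .of_step ?_
      simp only [latticeStep, if_neg hq.not_gt]
      exact key ht hs hq (by omega)
  obtain ⟨p, q, s, t⟩ := x
  obtain ⟨hs, ht⟩ := h
  simp only at hs ht
  rcases le_or_gt 0 q with hq | hq
  · exact key_pos hs ht hq
  rcases le_or_gt 0 p with hp | hp
  · exact reachesCycle_of_nonneg_of_le hs ht hp (by omega)
  refine .of_step ?_
  simp only [latticeStep, if_pos hq]
  rcases le_or_gt 0 (-p - s - 1) with h | h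
  · exact key_pos ht hs h
  refine .of_step ?_
  simp only [latticeStep, if_pos h]
  rcases le_or_gt 0 (-q - t - 1) with h' | h'
  · exact key_pos hs ht h'
  obtain rfl : p = -1 := by omega
  obtain rfl : q = -1 := by omega
  obtain rfl : s = 1 := by omega
  obtain rfl : t = 1 := by omega
  exact ⟨0, [2], Or.inr (Or.inl rfl), by simp, latticePath_two⟩

theorem LatticeValid.latticeWord_factor {x : ℤ × ℤ × ℤ × ℤ} (h : LatticeValid x) (n : ℕ) :
    ∃ w ∈ periodWords, ∃ m : ℕ, latticeWord x n <:+: (List.replicate m w).flatten := by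
  obtain ⟨m, w, hw, hne, hpath⟩ := h.reachesCycle
  refine ⟨w, hw, ?_⟩
  set c := latticeStep^[m] x with hc
  have hlen : 1 ≤ w.length := List.length_pos_iff.2 hne
  have hx : Function.IsPeriodicPt latticeStep w.length x := by
    refine latticeStep_injective.iterate m ?_
    rw [← Function.iterate_add_apply, add_comm, Function.iterate_add_apply]
    exact hpath.2
  have hxm : latticeStep^[w.length * m - m] c = x := by
    rw [hc, ← Function.iterate_add_apply,
      Nat.sub_add_cancel (Nat.le_mul_of_pos_left m hlen)]
    exact hx.mul_const m
  set j := w.length * m - m with hj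
  have hR := (hpath.replicate (j + n)).1
  obtain ⟨r, hr⟩ : ∃ r, ((List.replicate (j + n) w).flatten).length = j + n + r := by
    refine Nat.exists_eq_add_of_le ?_
    simpa using Nat.le_mul_of_pos_right (j + n) hlen
  refine ⟨j + n, latticeWord c j, latticeWord (latticeStep^[j + n] c) r, ?_⟩
  rw [hr, latticeWord_add, latticeWord_add, hxm] at hR
  exact hR

/-! ### Comparison of the piecewise rotation with the integer model -/

theorem pwRot_quarter (σ : ℝ) (z : ℂ) :
    pwRot (1 / 4) σ z = ⟨-z.im, z.re + σ + if 0 < z.im then 1 else -1⟩ := by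
  have h : Complex.exp (2 * Real.pi * ((1 / 4 : ℝ) : ℂ) * Complex.I) = Complex.I := by
    rw [show 2 * (Real.pi : ℂ) * ((1 / 4 : ℝ) : ℂ) * Complex.I = Real.pi / 2 * Complex.I by
        push_cast
        ring,
      Complex.exp_pi_div_two_mul_I]
  unfold pwRot
  rw [h]
  split_ifs <;> apply Complex.ext <;> simp <;> ring

/-- The class of a height, determined by its residue modulo `2`. -/
noncomputable def heightClass (σ y : ℝ) : ℤ := if y - 2 * ⌊y / 2⌋ ≤ σ + 1 then 0 else 1

theorem floor_heightClass_reflect {σ : ℝ} (h1 : 0 < σ) (h2 : σ < 1) (y : ℝ) (b : Prop)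
    [Decidable b] :
    ⌊(-y + σ + if b then 1 else -1) / 2⌋ = -⌊y / 2⌋ - heightClass σ y - (if b then 0 else 1) ∧
      heightClass σ (-y + σ + if b then 1 else -1) = heightClass σ y := by
  have hl := Int.floor_le (y / 2)
  have hu := Int.lt_floor_add_one (y / 2)
  have hfloor : ⌊(-y + σ + if b then 1 else -1) / 2⌋ =
      -⌊y / 2⌋ - heightClass σ y - (if b then 0 else 1) := by
    rw [Int.floor_eq_iff]
    unfold heightClass
    split_ifs <;> push_cast <;> constructor <;> linarith
  refine ⟨hfloor, ?_⟩
  rw [heightClass, hfloor]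
  unfold heightClass
  split_ifs <;> first | rfl | (exfalso; push_cast at *; linarith)

/-- The state of the integer model associated with a point. -/
noncomputable def latticeCode (σ : ℝ) (z : ℂ) : ℤ × ℤ × ℤ × ℤ :=
  (⌊z.im / 2⌋, ⌊(pwRot (1 / 4) σ z).im / 2⌋, heightClass σ z.im,
    heightClass σ (pwRot (1 / 4) σ z).im)

theorem latticeValid_latticeCode (σ : ℝ) (z : ℂ) : LatticeValid (latticeCode σ z) := by
  simp only [LatticeValid, latticeCode, heightClass]
  constructor <;> split_ifs <;> simp

theorem floor_half_nonneg_iff {y : ℝ} (hy : y ≠ 0) : 0 ≤ ⌊y / 2⌋ ↔ 0 < y := by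
  rw [Int.floor_nonneg]
  constructor
  · intro h
    exact lt_of_le_of_ne (by linarith) hy.symm
  · intro h
    positivity

theorem latticeCode_pwRot {σ : ℝ} (h1 : 0 < σ) (h2 : σ < 1) {z : ℂ}
    (hz : (pwRot (1 / 4) σ z).im ≠ 0) :
    latticeCode σ (pwRot (1 / 4) σ z) = latticeStep (latticeCode σ z) := by
  have him : (pwRot (1 / 4) σ (pwRot (1 / 4) σ z)).im =
      -z.im + σ + if 0 < (pwRot (1 / 4) σ z).im then 1 else -1 := by
    rw [pwRot_quarter σ (pwRot (1 / 4) σ z)]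
    simp only [pwRot_quarter σ z]
  obtain ⟨hf, hc⟩ := floor_heightClass_reflect h1 h2 z.im (0 < (pwRot (1 / 4) σ z).im)
  have hlt : ⌊(pwRot (1 / 4) σ z).im / 2⌋ < 0 ↔ ¬ 0 < (pwRot (1 / 4) σ z).im := by
    rw [← floor_half_nonneg_iff hz, not_le]
  simp only [latticeCode, latticeStep, him, hf, hc, hlt, ite_not]

theorem latticeLetter_latticeCode (σ : ℝ) {z : ℂ} (hz : z.im ≠ 0) :
    latticeLetter (latticeCode σ z) = if 0 < z.im then 1 else 2 := by
  simp only [latticeLetter, latticeCode, floor_half_nonneg_iff hz]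

theorem latticeCode_iterate {σ : ℝ} (h1 : 0 < σ) (h2 : σ < 1) {z : ℂ}
    (hz : goodOrbit (1 / 4) σ z) (n : ℕ) :
    latticeCode σ ((pwRot (1 / 4) σ)^[n] z) = latticeStep^[n] (latticeCode σ z) := by
  induction n with
  | zero => rfl
  | succ n ih =>
    have := hz (n + 1)
    rw [Function.iterate_succ_apply'] at this ⊢
    rw [Function.iterate_succ_apply', latticeCode_pwRot h1 h2 this, ih]

theorem itin_eq_latticeLetter {σ : ℝ} (h1 : 0 < σ) (h2 : σ < 1) {z : ℂ}
    (hz : goodOrbit (1 / 4) σ z) (n : ℕ) :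
    itin (1 / 4) σ z n = latticeLetter (latticeStep^[n] (latticeCode σ z)) := by
  rw [← latticeCode_iterate h1 h2 hz, latticeLetter_latticeCode σ (hz n), itin]

/-- A point realising a state of the integer model. -/
noncomputable def latticePoint (σ : ℝ) (x : ℤ × ℤ × ℤ × ℤ) : ℂ :=
  ⟨2 * x.2.1 + (σ + 1) / 2 + x.2.2.2 - σ - (if 0 ≤ x.1 then 1 else -1),
    2 * x.1 + (σ + 1) / 2 + x.2.2.1⟩

theorem latticePoint_im {σ : ℝ} (h1 : 0 < σ) (h2 : σ < 1) {x : ℤ × ℤ × ℤ × ℤ}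
    (hx : LatticeValid x) :
    (latticePoint σ x).im ≠ 0 ∧ (0 < (latticePoint σ x).im ↔ 0 ≤ x.1) := by
  have hs : (0 : ℝ) ≤ x.2.2.1 ∧ (x.2.2.1 : ℝ) ≤ 1 := by
    rcases hx.1 with h | h <;> simp [h]
  simp only [latticePoint]
  rcases le_or_gt 0 x.1 with h | h
  · have h' : (0 : ℝ) ≤ x.1 := by exact_mod_cast h
    have hpos : 0 < 2 * (x.1 : ℝ) + (σ + 1) / 2 + x.2.2.1 := by linarith
    exact ⟨hpos.ne', iff_of_true hpos h⟩
  · have h' : (x.1 : ℝ) ≤ -1 := by exact_mod_cast Int.le_sub_one_of_lt h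
    have hneg : 2 * (x.1 : ℝ) + (σ + 1) / 2 + x.2.2.1 < 0 := by linarith
    exact ⟨hneg.ne, iff_of_false hneg.not_gt h.not_ge⟩

theorem pwRot_latticePoint {σ : ℝ} (h1 : 0 < σ) (h2 : σ < 1) {x : ℤ × ℤ × ℤ × ℤ}
    (hx : LatticeValid x) :
    pwRot (1 / 4) σ (latticePoint σ x) = latticePoint σ (latticeStep x) := by
  rw [pwRot_quarter]
  simp only [(latticePoint_im h1 h2 hx).2]
  apply Complex.ext
  · simp only [latticePoint, latticeStep]
    rcases le_or_gt 0 x.2.1 with h | h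
    · simp only [h, h.not_gt, if_true, if_false]
      push_cast
      ring
    · simp only [h, h.not_ge, if_true, if_false]
      push_cast
      ring
  · simp only [latticePoint, latticeStep]
    ring

theorem pwRot_iterate_latticePoint {σ : ℝ} (h1 : 0 < σ) (h2 : σ < 1) {x : ℤ × ℤ × ℤ × ℤ}
    (hx : LatticeValid x) (n : ℕ) :
    (pwRot (1 / 4) σ)^[n] (latticePoint σ x) = latticePoint σ (latticeStep^[n] x) := by
  induction n with
  | zero => rfl
  | succ n ih =>
    rw [Function.iterate_succ_apply', ih, pwRot_latticePoint h1 h2 (hx.iterate n),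
      Function.iterate_succ_apply']

theorem mem_lang_quarter_iff {σ : ℝ} (h1 : 0 < σ) (h2 : σ < 1) (v : List ℕ) :
    v ∈ lang (1 / 4) σ ↔ ∃ x, LatticeValid x ∧ v = latticeWord x v.length := by
  constructor
  · rintro ⟨z, hz, i, hv⟩
    refine ⟨_, (latticeValid_latticeCode σ z).iterate i, ?_⟩
    rw [latticeWord_eq_map]
    refine hv.trans (List.map_congr_left fun k _ => ?_)
    rw [itin_eq_latticeLetter h1 h2 hz, add_comm, Function.iterate_add_apply]
  · rintro ⟨x, hx, hv⟩
    refine ⟨latticePoint σ x, fun n => ?_, 0, ?_⟩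
    · rw [pwRot_iterate_latticePoint h1 h2 hx]
      exact (latticePoint_im h1 h2 (hx.iterate n)).1
    · rw [latticeWord_eq_map] at hv
      refine hv.trans (List.map_congr_left fun k _ => ?_)
      rw [zero_add, itin, pwRot_iterate_latticePoint h1 h2 hx, latticeLetter]
      simp only [(latticePoint_im h1 h2 (hx.iterate k)).2]

theorem mem_lang_quarter_iff_factor {σ : ℝ} (h1 : 0 < σ) (h2 : σ < 1) (v : List ℕ) :
    v ∈ lang (1 / 4) σ ↔ ∃ w ∈ periodWords, ∃ m : ℕ, v <:+: (List.replicate m w).flatten := by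
  rw [mem_lang_quarter_iff h1 h2]
  constructor
  · rintro ⟨x, hx, hv⟩
    rw [hv]
    exact hx.latticeWord_factor v.length
  · rintro ⟨w, hw, m, hv⟩
    obtain ⟨x, hx, hpath⟩ := exists_latticePath_of_mem_periodWords hw
    obtain ⟨i, hi⟩ := (hpath.replicate m).eq_latticeWord_of_factor hv
    exact ⟨_, hx.iterate i, hi⟩

/-- For `θ = 1/4` and `σ ∈ (0,1)`, the language `L(T_{1/4,σ})` is exactly the set of
finite words over `{1,2}` which are factors of one of the periodic infinite words
`1^ω`, `2^ω`, or `(φ(s^n(X)))^ω` for `n ∈ ℕ` and `X ∈ {B,C,D}` (a factor of `w^ω`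
being an infix of some finite power of `w`). -/
theorem stmt_9 (σ : ℝ) (h1 : 0 < σ) (h2 : σ < 1) :
    lang (1/4) σ = {v : List ℕ |
      (∃ m : ℕ, v <:+: List.replicate m 1) ∨
      (∃ m : ℕ, v <:+: List.replicate m 2) ∨
      (∃ (n m : ℕ) (X : Letter), X ∈ ({Letter.B, Letter.C, Letter.D} : Set Letter) ∧
        v <:+: (List.replicate m ((substWord^[n] [X]).flatMap phiLetter)).flatten)} := by
  ext v
  have hflat : ∀ (m a : ℕ), (List.replicate m [a]).flatten = List.replicate m a := by
    simp
  rw [mem_lang_quarter_iff_factor h1 h2, Set.mem_ofPred_eq]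
  constructor
  · rintro ⟨w, rfl | rfl | ⟨n, X, hX, rfl⟩, m, hv⟩
    · exact Or.inl ⟨m, hflat m 1 ▸ hv⟩
    · exact Or.inr (Or.inl ⟨m, hflat m 2 ▸ hv⟩)
    · exact Or.inr (Or.inr ⟨n, m, X, hX, hv⟩)
  · rintro (⟨m, hv⟩ | ⟨m, hv⟩ | ⟨n, m, X, hX, hv⟩)
    · exact ⟨[1], Or.inl rfl, m, (hflat m 1).symm ▸ hv⟩
    · exact ⟨[2], Or.inr (Or.inl rfl), m, (hflat m 2).symm ▸ hv⟩
    · exact ⟨_, Or.inr (Or.inr ⟨n, X, hX, rfl⟩), m, hv⟩
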